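/- Let E be a complex Banach space having Rademacher type 2 with constant T ∈ (0,∞). Define, for f : 𝒞_n → E, σ(f) = max_{i∈{1,…,n}} log log(e + ‖∂_i f‖_{L_2(σ_n;E)} / ‖∂_i f‖_{L_1(σ_n;E)}) (with the convention that the i-th term is log log e when ∂_i f vanishes identically). Then there exists C = C(T) ∈ (0,∞) such that for every n ∈ ℕ and every function f : 𝒞_n → E, ‖f − E_{σ_n} f‖_{L_2(σ_n;E)}^2 ≤ C σ(f) ∑_{i=1}^n ‖∂_i f‖_{L_2(σ_n;E)}^2 / (1 + log(‖∂_i f‖_{L_2(σ_n;E)} / ‖∂_i f‖_{L_1(σ_n;E)})), the i-th summand interpreted as 0 when ∂_i f vanishes identically. -/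

import Mathlib

open Finset MeasureTheory Real Filter

noncomputable section

/-- The discrete hypercube `𝒞_n = {-1,1}^n`, encoded as `Fin n → Bool`. -/
abbrev Cube (n : ℕ) := Fin n → Bool

/-- The sign `±1` associated to a boolean coordinate. -/
def sgn' (b : Bool) : ℝ := if b then 1 else -1

/-- Flip the `i`-th coordinate of a point of the hypercube. -/
def flipC {n : ℕ} (i : Fin n) (x : Cube n) : Cube n := Function.update x i (!(x i))

variable {E : Type*} [NormedAddCommGroup E]

/-- Expectation `E_{σ_n} f` with respect to the uniform probability measure on the cube. -/
def cubeAvg {n : ℕ} [NormedSpace ℝ E] (f : Cube n → E) : E :=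
  (2 ^ n : ℝ)⁻¹ • ∑ x : Cube n, f x

/-- The discrete partial derivative `∂_i f (ε) = (f(ε) - f(ε with i-th coordinate flipped))/2`. -/
def dparC {n : ℕ} [NormedSpace ℝ E] (i : Fin n) (f : Cube n → E) : Cube n → E :=
  fun x => (2 : ℝ)⁻¹ • (f x - f (flipC i x))

/-- The `L_p(σ_n; E)` norm of a function on the hypercube. -/
def cubeLp {n : ℕ} (p : ℝ) (f : Cube n → E) : ℝ :=
  ((2 ^ n : ℝ)⁻¹ * ∑ x : Cube n, ‖f x‖ ^ p) ^ (1 / p)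

theorem sgn'_mul_self (b : Bool) : sgn' b * sgn' b = 1 := by cases b <;> simp [sgn']

theorem sgn'_sq (b : Bool) : sgn' b ^ 2 = 1 := by cases b <;> simp [sgn']

theorem sgn'_not (b : Bool) : sgn' (!b) = -sgn' b := by cases b <;> simp [sgn']

theorem flipC_involutive {n : ℕ} (i : Fin n) : Function.Involutive (flipC i) := by
  intro x
  simp [flipC]

theorem sum_flipC {M : Type*} [AddCommMonoid M] {n : ℕ} (i : Fin n) (g : Cube n → M) :
    ∑ x, g (flipC i x) = ∑ x, g x :=
  Equiv.sum_comp (flipC_involutive i).toPerm g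

/-- The transition kernel of the noise operator on one coordinate. -/
def signKernel (ρ : ℝ) (a b : Bool) : ℝ := (1 + ρ * (sgn' a * sgn' b)) / 2

/-- The transition kernel of the noise operator on the hypercube. -/
def noiseKernel {n : ℕ} (ρ : ℝ) (x y : Cube n) : ℝ := ∏ i, signKernel ρ (x i) (y i)

/-- The noise operator `T_ρ` on the hypercube. -/
def noiseOp {n : ℕ} [NormedSpace ℝ E] (ρ : ℝ) (f : Cube n → E) : Cube n → E :=
  fun x => ∑ y, noiseKernel ρ x y • f y

theorem sum_cube_prod {n : ℕ} (g : Fin n → Bool → ℝ) :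
    ∑ x : Cube n, ∏ i, g i (x i) = ∏ i, ∑ b, g i b := by
  rw [Finset.prod_univ_sum, Fintype.piFinset_univ]

theorem signKernel_comm (ρ : ℝ) (a b : Bool) : signKernel ρ a b = signKernel ρ b a := by
  simp [signKernel, mul_comm]

theorem noiseKernel_comm {n : ℕ} (ρ : ℝ) (x y : Cube n) :
    noiseKernel ρ x y = noiseKernel ρ y x :=
  Finset.prod_congr rfl fun _ _ => signKernel_comm _ _ _

theorem signKernel_nonneg {ρ : ℝ} (h0 : 0 ≤ ρ) (h1 : ρ ≤ 1) (a b : Bool) :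
    0 ≤ signKernel ρ a b := by
  cases a <;> cases b <;> simp [signKernel, sgn'] <;> linarith

theorem noiseKernel_nonneg {n : ℕ} {ρ : ℝ} (h0 : 0 ≤ ρ) (h1 : ρ ≤ 1) (x y : Cube n) :
    0 ≤ noiseKernel ρ x y :=
  Finset.prod_nonneg fun _ _ => signKernel_nonneg h0 h1 _ _

theorem sum_noiseKernel_mul_coord {n : ℕ} (ρ : ℝ) (y : Cube n) (i : Fin n) (h : Bool → ℝ) :
    ∑ x, noiseKernel ρ x y * h (x i) = ∑ b, signKernel ρ b (y i) * h b := by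
  have key : ∀ x : Cube n, noiseKernel ρ x y * h (x i) =
      ∏ j, (signKernel ρ (x j) (y j) * if j = i then h (x j) else 1) := by
    intro x
    rw [Finset.prod_mul_distrib, Finset.prod_ite_eq' Finset.univ i (fun j => h (x j))]
    simp [noiseKernel]
  simp_rw [key]
  rw [sum_cube_prod (fun j b => signKernel ρ b (y j) * if j = i then h b else 1),
    Finset.prod_eq_single i]
  · simp
  · intro j _ hj
    cases hb : y j <;> simp [hj, signKernel, sgn'] <;> ring
  · simp

theorem sum_noiseKernel_left {n : ℕ} (ρ : ℝ) (y : Cube n) : ∑ x, noiseKernel ρ x y = 1 := by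
  unfold noiseKernel
  rw [sum_cube_prod (fun j b => signKernel ρ b (y j))]
  apply Finset.prod_eq_one
  intro j _
  cases hb : y j <;> simp [signKernel, sgn'] <;> ring

theorem sum_noiseKernel_right {n : ℕ} (ρ : ℝ) (x : Cube n) : ∑ y, noiseKernel ρ x y = 1 := by
  simp_rw [noiseKernel_comm ρ x]
  exact sum_noiseKernel_left ρ x

theorem sum_noiseKernel_mul_sgn {n : ℕ} (ρ : ℝ) (y : Cube n) (i : Fin n) :
    ∑ x, noiseKernel ρ x y * sgn' (x i) = ρ * sgn' (y i) := by
  rw [sum_noiseKernel_mul_coord]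
  cases hb : y i <;> simp [signKernel, sgn'] <;> ring

theorem sum_noiseKernel_mul_noiseKernel {n : ℕ} (ρ r : ℝ) (x z : Cube n) :
    ∑ y, noiseKernel ρ x y * noiseKernel r y z = noiseKernel (ρ * r) x z := by
  simp_rw [noiseKernel, ← Finset.prod_mul_distrib]
  rw [sum_cube_prod (fun j b => signKernel ρ (x j) b * signKernel r b (z j))]
  refine Finset.prod_congr rfl fun j _ => ?_
  cases x j <;> cases z j <;> simp [signKernel, sgn'] <;> ring

theorem noiseKernel_flipC_flipC {n : ℕ} (ρ : ℝ) (i : Fin n) (x y : Cube n) :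
    noiseKernel ρ (flipC i x) (flipC i y) = noiseKernel ρ x y := by
  refine Finset.prod_congr rfl fun j _ => ?_
  by_cases h : j = i
  · subst h
    simp [flipC, signKernel, sgn'_not]
  · simp [flipC, h]

theorem noiseKernel_zero {n : ℕ} (x y : Cube n) : noiseKernel 0 x y = (2 ^ n : ℝ)⁻¹ := by
  simp [noiseKernel, signKernel]

theorem noiseKernel_one {n : ℕ} (x y : Cube n) :
    noiseKernel 1 x y = if x = y then 1 else 0 := by
  split_ifs with h
  · subst h
    refine Finset.prod_eq_one fun i _ => ?_
    simp [signKernel, sgn'_mul_self]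
  · obtain ⟨i, hi⟩ := Function.ne_iff.mp h
    refine Finset.prod_eq_zero (Finset.mem_univ i) ?_
    revert hi
    cases x i <;> cases y i <;> simp [signKernel, sgn']

section NoiseOp

variable [NormedSpace ℝ E] {n : ℕ}

theorem noiseOp_zero (f : Cube n → E) : noiseOp 0 f = fun _ => cubeAvg f := by
  funext x
  simp [noiseOp, noiseKernel_zero, cubeAvg, Finset.smul_sum]

theorem noiseOp_one (f : Cube n → E) : noiseOp 1 f = f := by
  funext x
  simp [noiseOp, noiseKernel_one]

theorem noiseOp_noiseOp (ρ r : ℝ) (f : Cube n → E) :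
    noiseOp ρ (noiseOp r f) = noiseOp (ρ * r) f := by
  funext x
  simp only [noiseOp, Finset.smul_sum, smul_smul]
  rw [Finset.sum_comm]
  simp_rw [← Finset.sum_smul, sum_noiseKernel_mul_noiseKernel]

theorem noiseOp_flipC (ρ : ℝ) (i : Fin n) (f : Cube n → E) (x : Cube n) :
    noiseOp ρ f (flipC i x) = noiseOp ρ (fun y => f (flipC i y)) x := by
  simp only [noiseOp]
  rw [← sum_flipC i]
  simp_rw [noiseKernel_flipC_flipC]

theorem dparC_noiseOp (ρ : ℝ) (i : Fin n) (f : Cube n → E) :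
    dparC i (noiseOp ρ f) = noiseOp ρ (dparC i f) := by
  funext x
  change (2 : ℝ)⁻¹ • (noiseOp ρ f x - noiseOp ρ f (flipC i x)) = noiseOp ρ (dparC i f) x
  rw [noiseOp_flipC]
  simp only [dparC, noiseOp, smul_sub, Finset.smul_sum, Finset.sum_sub_distrib]
  simp_rw [smul_comm (2 : ℝ)⁻¹]

theorem norm_noiseOp_le {ρ : ℝ} (h0 : 0 ≤ ρ) (h1 : ρ ≤ 1) (f : Cube n → E) (x : Cube n) :
    ‖noiseOp ρ f x‖ ≤ noiseOp ρ (fun y => ‖f y‖) x := by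
  refine (norm_sum_le _ _).trans (le_of_eq (Finset.sum_congr rfl fun y _ => ?_))
  rw [norm_smul, Real.norm_of_nonneg (noiseKernel_nonneg h0 h1 x y), smul_eq_mul]

theorem norm_sum_smul_sq_le {ι : Type*} [Fintype ι] (w : ι → ℝ) (hw : ∀ i, 0 ≤ w i)
    (hw1 : ∑ i, w i = 1) (v : ι → E) : ‖∑ i, w i • v i‖ ^ 2 ≤ ∑ i, w i * ‖v i‖ ^ 2 := by
  have h1 : ‖∑ i, w i • v i‖ ≤ ∑ i, w i * ‖v i‖ := by
    refine (norm_sum_le _ _).trans (le_of_eq (Finset.sum_congr rfl fun y _ => ?_))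
    rw [norm_smul, Real.norm_of_nonneg (hw y)]
  refine (pow_le_pow_left₀ (norm_nonneg _) h1 2).trans ?_
  exact Real.pow_arith_mean_le_arith_mean_pow Finset.univ w (fun i => ‖v i‖)
    (fun i _ => hw i) hw1 (fun i _ => norm_nonneg _) 2

theorem signKernel_mul_sub (ρ : ℝ) (a b : Bool) :
    signKernel ρ a b * (sgn' a * sgn' b - ρ) = (1 - ρ ^ 2) * (sgn' a * sgn' b / 2) := by
  cases a <;> cases b <;> simp [signKernel, sgn'] <;> ring

theorem noiseKernel_mul_sub (ρ : ℝ) (x y : Cube n) (i : Fin n) :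
    noiseKernel ρ x y * (sgn' (x i) * sgn' (y i) - ρ) =
      (1 - ρ ^ 2) * ((∏ j ∈ Finset.univ.erase i, signKernel ρ (x j) (y j)) *
        (sgn' (x i) * sgn' (y i) / 2)) := by
  rw [noiseKernel, ← Finset.mul_prod_erase _ _ (Finset.mem_univ i)]
  linear_combination (∏ j ∈ Finset.univ.erase i, signKernel ρ (x j) (y j)) *
    signKernel_mul_sub ρ (x i) (y i)

theorem hasDerivAt_noiseKernel (x y : Cube n) {ρ : ℝ} (hρ : 1 - ρ ^ 2 ≠ 0) :
    HasDerivAt (fun s => noiseKernel s x y)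
      ((1 - ρ ^ 2)⁻¹ * (noiseKernel ρ x y * ∑ i, (sgn' (x i) * sgn' (y i) - ρ))) ρ := by
  have h : ∀ i ∈ Finset.univ, HasDerivAt (fun s => signKernel s (x i) (y i))
      (sgn' (x i) * sgn' (y i) / 2) ρ := by
    intro i _
    have := (((hasDerivAt_id ρ).mul_const (sgn' (x i) * sgn' (y i))).const_add 1).div_const 2
    simpa [signKernel] using this
  have h2 := HasDerivAt.fun_finsetProd h
  refine h2.congr_deriv ?_
  simp_rw [Finset.mul_sum, noiseKernel_mul_sub, inv_mul_cancel_left₀ hρ, smul_eq_mul]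

theorem sum_noiseKernel_smul_dparC (ρ : ℝ) (x : Cube n) (i : Fin n) (f : Cube n → E) :
    ∑ y, (noiseKernel ρ x y * (sgn' (x i) * sgn' (y i) - ρ)) • dparC i f y =
      ∑ y, (noiseKernel ρ x y * (sgn' (x i) * sgn' (y i) - ρ)) • f y := by
  set c : Cube n → ℝ := fun y => noiseKernel ρ x y * (sgn' (x i) * sgn' (y i) - ρ) with hc
  have hflip : ∀ y, c (flipC i y) = -c y := by
    intro y
    simp only [hc, noiseKernel_mul_sub]
    have : ∏ j ∈ Finset.univ.erase i, signKernel ρ (x j) (flipC i y j) =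
        ∏ j ∈ Finset.univ.erase i, signKernel ρ (x j) (y j) :=
      Finset.prod_congr rfl fun j hj => by simp [flipC, Finset.ne_of_mem_erase hj]
    rw [this]
    simp only [flipC, Function.update_self, sgn'_not]
    ring
  have h1 : ∑ y, c y • f (flipC i y) = -∑ y, c y • f y := by
    rw [← sum_flipC i (fun y => c y • f y)]
    simp [hflip]
  have h2 : ∀ y, c y • dparC i f y = (2 : ℝ)⁻¹ • (c y • f y - c y • f (flipC i y)) := by
    intro y
    rw [dparC, smul_comm, smul_sub]
  change ∑ y, c y • dparC i f y = ∑ y, c y • f y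
  simp_rw [h2, ← Finset.smul_sum, Finset.sum_sub_distrib, h1, sub_neg_eq_add, ← two_smul ℝ,
    smul_smul]
  norm_num

/-- The derivative of `ρ ↦ T_ρ f`, written in terms of the partial derivatives of `f`. -/
def noiseDeriv (ρ : ℝ) (f : Cube n → E) : Cube n → E :=
  fun x => (1 - ρ ^ 2)⁻¹ •
    ∑ y, noiseKernel ρ x y • ∑ i, (sgn' (x i) * sgn' (y i) - ρ) • dparC i f y

theorem hasDerivAt_noiseOp (f : Cube n → E) (x : Cube n) {ρ : ℝ} (hρ : 1 - ρ ^ 2 ≠ 0) :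
    HasDerivAt (fun s => noiseOp s f x) (noiseDeriv ρ f x) ρ := by
  have h := HasDerivAt.fun_sum (u := Finset.univ)
    fun y _ => (hasDerivAt_noiseKernel x y hρ).smul_const (f y)
  refine h.congr_deriv ?_
  simp only [noiseDeriv, Finset.smul_sum, Finset.mul_sum, Finset.sum_smul, smul_smul]
  rw [Finset.sum_comm]
  conv_rhs => rw [Finset.sum_comm]
  refine Finset.sum_congr rfl fun i _ => ?_
  simp_rw [← smul_smul, ← Finset.smul_sum]
  congr 1
  simpa only [smul_smul] using (sum_noiseKernel_smul_dparC ρ x i f).symm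

end NoiseOp

/-- `E` has Rademacher type `2` with constant `T`. -/
def HasTypeTwo (E : Type*) [NormedAddCommGroup E] [NormedSpace ℝ E] (T : ℝ) : Prop :=
  ∀ (m : ℕ) (v : Fin m → E),
    (2 ^ m : ℝ)⁻¹ * ∑ ε : Cube m, ‖∑ i, sgn' (ε i) • v i‖ ^ 2 ≤ T ^ 2 * ∑ i, ‖v i‖ ^ 2

/-- Exchange the coordinates of a pair of points of the cube on the set `{i | ε i = false}`. -/
def coordSwap {n : ℕ} (ε : Cube n) (p : Cube n × Cube n) : Cube n × Cube n :=
  (fun i => if ε i then p.1 i else p.2 i, fun i => if ε i then p.2 i else p.1 i)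

theorem coordSwap_involutive {n : ℕ} (ε : Cube n) : Function.Involutive (coordSwap ε) := by
  intro p
  refine Prod.ext ?_ ?_ <;> funext i <;> cases h : ε i <;> simp [coordSwap, h]

section TypeTwo

variable [NormedSpace ℝ E] {n : ℕ}

theorem noiseKernel_mul_coordSwap (ρ : ℝ) (ε y : Cube n) (p : Cube n × Cube n) :
    noiseKernel ρ (coordSwap ε p).1 y * noiseKernel ρ (coordSwap ε p).2 y =
      noiseKernel ρ p.1 y * noiseKernel ρ p.2 y := by
  simp_rw [noiseKernel, ← Finset.prod_mul_distrib]
  refine Finset.prod_congr rfl fun i _ => ?_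
  cases h : ε i <;> simp [coordSwap, h, mul_comm]

theorem sum_sgn'_sub_smul_coordSwap (ε : Cube n) (p : Cube n × Cube n) (u : Fin n → E) :
    ∑ i, (sgn' ((coordSwap ε p).1 i) - sgn' ((coordSwap ε p).2 i)) • u i =
      ∑ i, sgn' (ε i) • (sgn' (p.1 i) - sgn' (p.2 i)) • u i := by
  refine Finset.sum_congr rfl fun i _ => ?_
  rw [smul_smul]
  congr 1
  cases h : ε i <;> simp [coordSwap, h, sgn']

theorem sum_noiseKernel_mul_sgn'_sub_sq (ρ : ℝ) (y : Cube n) (i : Fin n) :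
    ∑ p : Cube n × Cube n, noiseKernel ρ p.1 y * noiseKernel ρ p.2 y *
      (sgn' (p.1 i) - sgn' (p.2 i)) ^ 2 = 2 * (1 - ρ ^ 2) := by
  have h : ∀ p : Cube n × Cube n, noiseKernel ρ p.1 y * noiseKernel ρ p.2 y *
      (sgn' (p.1 i) - sgn' (p.2 i)) ^ 2 =
      2 * (noiseKernel ρ p.1 y * noiseKernel ρ p.2 y) -
      2 * ((noiseKernel ρ p.1 y * sgn' (p.1 i)) * (noiseKernel ρ p.2 y * sgn' (p.2 i))) := by
    intro p
    linear_combination (noiseKernel ρ p.1 y * noiseKernel ρ p.2 y) *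
      (sgn'_sq (p.1 i) + sgn'_sq (p.2 i))
  simp_rw [h, Finset.sum_sub_distrib, ← Finset.mul_sum, Fintype.sum_prod_type, ← Finset.mul_sum,
    ← Finset.sum_mul, sum_noiseKernel_mul_sgn, sum_noiseKernel_left]
  linear_combination -2 * ρ ^ 2 * sgn'_sq (y i)

theorem HasTypeTwo.sum_noiseKernel_mul_norm_sq_le {T : ℝ} (hE : HasTypeTwo E T) {ρ : ℝ}
    (h0 : 0 ≤ ρ) (h1 : ρ ≤ 1) (y : Cube n) (v : Fin n → E) :
    ∑ x, noiseKernel ρ x y * ‖∑ i, (sgn' (x i) * sgn' (y i) - ρ) • v i‖ ^ 2 ≤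
      2 * T ^ 2 * (1 - ρ ^ 2) * ∑ i, ‖v i‖ ^ 2 := by
  set u : Fin n → E := fun i => sgn' (y i) • v i with hu
  set W : Cube n × Cube n → ℝ := fun p => noiseKernel ρ p.1 y * noiseKernel ρ p.2 y with hW
  have hW0 : ∀ p, 0 ≤ W p := fun p =>
    mul_nonneg (noiseKernel_nonneg h0 h1 _ _) (noiseKernel_nonneg h0 h1 _ _)
  have hnorm : ∀ i, ‖u i‖ = ‖v i‖ := by
    intro i
    cases h : y i <;> simp [hu, h, sgn']
  have hmean : ∀ x : Cube n, ∑ i, (sgn' (x i) * sgn' (y i) - ρ) • v i =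
      ∑ x', noiseKernel ρ x' y • ∑ i, (sgn' (x i) - sgn' (x' i)) • u i := by
    intro x
    simp_rw [Finset.smul_sum, smul_smul]
    rw [Finset.sum_comm]
    refine Finset.sum_congr rfl fun i _ => ?_
    rw [← Finset.sum_smul]
    simp_rw [mul_sub, Finset.sum_sub_distrib, ← Finset.sum_mul, sum_noiseKernel_left,
      sum_noiseKernel_mul_sgn]
    rw [hu, smul_smul]
    congr 1
    linear_combination ρ * sgn'_sq (y i)
  have hjensen : ∑ x, noiseKernel ρ x y * ‖∑ i, (sgn' (x i) * sgn' (y i) - ρ) • v i‖ ^ 2 ≤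
      ∑ p : Cube n × Cube n, W p * ‖∑ i, (sgn' (p.1 i) - sgn' (p.2 i)) • u i‖ ^ 2 := by
    rw [Fintype.sum_prod_type]
    refine Finset.sum_le_sum fun x _ => ?_
    rw [hmean x]
    refine (mul_le_mul_of_nonneg_left (norm_sum_smul_sq_le _
      (fun x' => noiseKernel_nonneg h0 h1 x' y) (sum_noiseKernel_left ρ y) _)
      (noiseKernel_nonneg h0 h1 x y)).trans (le_of_eq ?_)
    simp only [hW, Finset.mul_sum, mul_assoc]
  have hsymm : ∀ ε : Cube n,
      ∑ p : Cube n × Cube n, W p * ‖∑ i, (sgn' (p.1 i) - sgn' (p.2 i)) • u i‖ ^ 2 =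
      ∑ p : Cube n × Cube n,
        W p * ‖∑ i, sgn' (ε i) • (sgn' (p.1 i) - sgn' (p.2 i)) • u i‖ ^ 2 := by
    intro ε
    rw [← Equiv.sum_comp (coordSwap_involutive ε).toPerm]
    refine Finset.sum_congr rfl fun p _ => ?_
    simp only [Function.Involutive.coe_toPerm, sum_sgn'_sub_smul_coordSwap, hW,
      noiseKernel_mul_coordSwap]
  have havg : ∑ p : Cube n × Cube n, W p * ‖∑ i, (sgn' (p.1 i) - sgn' (p.2 i)) • u i‖ ^ 2 =
      ∑ p : Cube n × Cube n, W p * ((2 ^ n : ℝ)⁻¹ *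
        ∑ ε : Cube n, ‖∑ i, sgn' (ε i) • (sgn' (p.1 i) - sgn' (p.2 i)) • u i‖ ^ 2) := by
    have hp : ∀ (p : Cube n × Cube n) (F : Cube n → ℝ),
        W p * ((2 ^ n : ℝ)⁻¹ * ∑ ε, F ε) = (2 ^ n : ℝ)⁻¹ * ∑ ε, W p * F ε := by
      intro p F
      rw [mul_left_comm, Finset.mul_sum]
    simp_rw [hp]
    rw [← Finset.mul_sum, Finset.sum_comm, ← Finset.sum_congr rfl fun ε _ => hsymm ε]
    simp
  refine hjensen.trans (havg.trans_le ?_)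
  refine (Finset.sum_le_sum fun p _ => mul_le_mul_of_nonneg_left (hE n _) (hW0 p)).trans ?_
  refine le_of_eq ?_
  have hp : ∀ p : Cube n × Cube n,
      W p * (T ^ 2 * ∑ i, ‖(sgn' (p.1 i) - sgn' (p.2 i)) • u i‖ ^ 2) =
      T ^ 2 * ∑ i, (W p * (sgn' (p.1 i) - sgn' (p.2 i)) ^ 2) * ‖v i‖ ^ 2 := by
    intro p
    simp_rw [norm_smul, mul_pow, hnorm, Real.norm_eq_abs, sq_abs, Finset.mul_sum]
    exact Finset.sum_congr rfl fun i _ => by ring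
  simp_rw [hp]
  rw [← Finset.mul_sum, Finset.sum_comm]
  simp_rw [← Finset.sum_mul, hW, sum_noiseKernel_mul_sgn'_sub_sq, ← Finset.mul_sum]
  ring

theorem HasTypeTwo.sum_norm_noiseDeriv_sq_le {T : ℝ} (hE : HasTypeTwo E T) {ρ : ℝ}
    (h0 : 0 ≤ ρ) (h1 : ρ < 1) (f : Cube n → E) :
    ∑ x, ‖noiseDeriv ρ f x‖ ^ 2 ≤
      2 * T ^ 2 * (1 - ρ ^ 2)⁻¹ * ∑ i, ∑ x, ‖dparC i f x‖ ^ 2 := by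
  have hρ : 0 < 1 - ρ ^ 2 := by nlinarith
  have hx : ∀ x, ‖noiseDeriv ρ f x‖ ^ 2 ≤ ((1 - ρ ^ 2)⁻¹) ^ 2 * ∑ y, noiseKernel ρ x y *
      ‖∑ i, (sgn' (x i) * sgn' (y i) - ρ) • dparC i f y‖ ^ 2 := by
    intro x
    rw [noiseDeriv, norm_smul, mul_pow, Real.norm_eq_abs, sq_abs]
    exact mul_le_mul_of_nonneg_left (norm_sum_smul_sq_le _
      (fun y => noiseKernel_nonneg h0 h1.le x y) (sum_noiseKernel_right ρ x) _) (sq_nonneg _)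
  refine (Finset.sum_le_sum fun x _ => hx x).trans ?_
  rw [← Finset.mul_sum, Finset.sum_comm]
  refine (mul_le_mul_of_nonneg_left (Finset.sum_le_sum fun y _ =>
    hE.sum_noiseKernel_mul_norm_sq_le h0 h1.le y (fun i => dparC i f y)) (sq_nonneg _)).trans ?_
  rw [← Finset.mul_sum, Finset.sum_comm]
  refine le_of_eq ?_
  field_simp

theorem HasTypeTwo.norm_sub_noiseOp_le {T : ℝ} (hE : HasTypeTwo E T) {ρ : ℝ}
    (h0 : 0 ≤ ρ) (h1 : ρ ≤ 1) (f : Cube n → E) :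
    ∑ x, ‖f x - noiseOp ρ f x‖ ^ 2 ≤
      8 * T ^ 2 * (1 - ρ) * ∑ i, ∑ x, ‖dparC i f x‖ ^ 2 := by
  set S : ℝ := ∑ i, ∑ x, ‖dparC i f x‖ ^ 2 with hS
  have hS0 : 0 ≤ S := Finset.sum_nonneg fun i _ => Finset.sum_nonneg fun x _ => sq_nonneg _
  set D : ℝ := √(2 * T ^ 2 * S) with hD
  let L := (PiLp.continuousLinearEquiv 2 ℝ (fun _ : Cube n => E)).symm
  have hnorm : ∀ g : Cube n → E, ‖L g‖ ^ 2 = ∑ x, ‖g x‖ ^ 2 := by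
    intro g
    rw [PiLp.norm_sq_eq_of_L2]
    rfl
  have hcont : Continuous fun s : ℝ => L (fun x => noiseOp s f x - noiseOp ρ f x) := by
    refine L.continuous.comp (continuous_pi fun x => ?_)
    simp only [noiseOp, noiseKernel, signKernel]
    fun_prop
  have hderiv : ∀ s ∈ Set.Ico ρ 1, HasDerivWithinAt
      (fun s : ℝ => L (fun x => noiseOp s f x - noiseOp ρ f x)) (L (noiseDeriv s f))
      (Set.Ici s) s := by
    intro s hs
    have hs' : 1 - s ^ 2 ≠ 0 := by nlinarith [hs.1, hs.2]
    refine HasDerivAt.hasDerivWithinAt ?_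
    exact L.hasFDerivAt.comp_hasDerivAt s
      (hasDerivAt_pi.2 fun x => (hasDerivAt_noiseOp f x hs').sub_const _)
  have hB : ∀ s ∈ Set.Ico ρ 1, HasDerivWithinAt (fun s : ℝ => 2 * D * (√(1 - ρ) - √(1 - s)))
      (D / √(1 - s)) (Set.Ici s) s := by
    intro s hs
    have hs' : 1 - s ≠ 0 := by linarith [hs.2]
    have := ((((hasDerivAt_id s).const_sub 1).sqrt hs').const_sub (√(1 - ρ))).const_mul (2 * D)
    refine (this.congr_deriv ?_).hasDerivWithinAt
    have h2 : √(1 - s) ≠ 0 := (Real.sqrt_pos.2 (by linarith [hs.2])).ne'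
    simp only [id]
    field_simp
  have hbound : ∀ s ∈ Set.Ico ρ 1, ‖L (noiseDeriv s f)‖ ≤ D / √(1 - s) := by
    intro s hs
    have hs0 : 0 ≤ s := h0.trans hs.1
    have hs1 : 0 < 1 - s := by linarith [hs.2]
    rw [hD, ← Real.sqrt_div (by positivity)]
    refine Real.le_sqrt_of_sq_le ?_
    rw [hnorm]
    refine (hE.sum_norm_noiseDeriv_sq_le hs0 hs.2 f).trans ?_
    rw [div_eq_mul_inv, ← hS]
    have : (1 - s ^ 2)⁻¹ ≤ (1 - s)⁻¹ := inv_anti₀ hs1 (by nlinarith)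
    calc 2 * T ^ 2 * (1 - s ^ 2)⁻¹ * S = 2 * T ^ 2 * S * (1 - s ^ 2)⁻¹ := by ring
      _ ≤ _ := mul_le_mul_of_nonneg_left this (by positivity)
  have key := image_norm_le_of_norm_deriv_right_le_deriv_boundary' hcont.continuousOn hderiv
    (B := fun s : ℝ => 2 * D * (√(1 - ρ) - √(1 - s))) (by simp [← Pi.zero_def])
    (by fun_prop) hB hbound (Set.right_mem_Icc.2 h1)
  simp only [noiseOp_one, sub_self, Real.sqrt_zero, sub_zero] at key
  rw [← hnorm]
  refine (pow_le_pow_left₀ (norm_nonneg _) key 2).trans (le_of_eq ?_)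
  rw [mul_pow, mul_pow, hD, Real.sq_sqrt (by positivity), Real.sq_sqrt (by linarith)]
  ring

end TypeTwo

section Hypercontractivity

variable {n : ℕ}

theorem sum_cube_succ (F : Cube (n + 1) → ℝ) :
    ∑ x, F x = ∑ x : Cube n, F (Fin.cons true x) + ∑ x : Cube n, F (Fin.cons false x) := by
  rw [← Equiv.sum_comp (Fin.consEquiv fun _ => Bool), Fintype.sum_prod_type]
  simp [Fin.consEquiv]

theorem noiseKernel_cons (ρ : ℝ) (a b : Bool) (x y : Cube n) :
    noiseKernel ρ (Fin.cons a x : Cube (n + 1)) (Fin.cons b y) =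
      signKernel ρ a b * noiseKernel ρ x y := by
  simp [noiseKernel, Fin.prod_univ_succ]

theorem noiseOp_cons (ρ : ℝ) (g : Cube (n + 1) → ℝ) (a : Bool) (x : Cube n) :
    noiseOp ρ g (Fin.cons a x) =
      signKernel ρ a true * noiseOp ρ (fun y => g (Fin.cons true y)) x +
      signKernel ρ a false * noiseOp ρ (fun y => g (Fin.cons false y)) x := by
  simp only [noiseOp, sum_cube_succ, noiseKernel_cons, smul_eq_mul, mul_assoc, Finset.mul_sum]

/-- Hypercontractivity of `T_{1/2}` from `L_2` to `L_4`. -/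
theorem sum_noiseOp_half_pow_four_le (g : Cube n → ℝ) :
    ∑ x, noiseOp (1 / 2) g x ^ 4 ≤ (2 ^ n : ℝ)⁻¹ * (∑ x, g x ^ 2) ^ 2 := by
  induction n with
  | zero => simp [noiseOp, noiseKernel, ← pow_mul]
  | succ n ih =>
    set a : Cube n → ℝ := fun x => (g (Fin.cons true x) + g (Fin.cons false x)) / 2 with ha
    set b : Cube n → ℝ := fun x => (g (Fin.cons true x) - g (Fin.cons false x)) / 2 with hb
    have hTa : ∀ x, noiseOp (1 / 2) a x =
        (noiseOp (1 / 2) (fun y => g (Fin.cons true y)) x +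
          noiseOp (1 / 2) (fun y => g (Fin.cons false y)) x) / 2 := by
      intro x
      simp only [noiseOp, ha, smul_eq_mul, ← Finset.sum_add_distrib, Finset.sum_div]
      exact Finset.sum_congr rfl fun y _ => by ring
    have hTb : ∀ x, noiseOp (1 / 2) b x =
        (noiseOp (1 / 2) (fun y => g (Fin.cons true y)) x -
          noiseOp (1 / 2) (fun y => g (Fin.cons false y)) x) / 2 := by
      intro x
      simp only [noiseOp, hb, smul_eq_mul, ← Finset.sum_sub_distrib, Finset.sum_div]
      exact Finset.sum_congr rfl fun y _ => by ring
    have hleft : ∑ x, noiseOp (1 / 2) g x ^ 4 = 2 * ∑ x, noiseOp (1 / 2) a x ^ 4 +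
        3 * ∑ x, noiseOp (1 / 2) a x ^ 2 * noiseOp (1 / 2) b x ^ 2 +
        1 / 8 * ∑ x, noiseOp (1 / 2) b x ^ 4 := by
      rw [sum_cube_succ]
      simp only [Finset.mul_sum, ← Finset.sum_add_distrib]
      refine Finset.sum_congr rfl fun x _ => ?_
      rw [noiseOp_cons, noiseOp_cons, hTa, hTb]
      simp only [signKernel, sgn']
      norm_num
      ring
    have hright : ∑ x, g x ^ 2 = 2 * (∑ x, a x ^ 2 + ∑ x, b x ^ 2) := by
      rw [sum_cube_succ]
      simp only [Finset.mul_sum, ← Finset.sum_add_distrib]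
      refine Finset.sum_congr rfl fun x _ => ?_
      simp only [ha, hb]
      ring
    have hcs := Finset.sum_mul_sq_le_sq_mul_sq Finset.univ
      (fun x => noiseOp (1 / 2) a x ^ 2) (fun x => noiseOp (1 / 2) b x ^ 2)
    simp only [← pow_mul] at hcs
    have hA := ih a
    have hB := ih b
    rw [hleft, hright, pow_succ, mul_inv]
    set A := ∑ x, a x ^ 2
    set B := ∑ x, b x ^ 2
    set c := (2 ^ n : ℝ)⁻¹
    have hA0 : 0 ≤ A := Finset.sum_nonneg fun _ _ => sq_nonneg _
    have hB0 : 0 ≤ B := Finset.sum_nonneg fun _ _ => sq_nonneg _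
    have hc0 : 0 ≤ c := by positivity
    have hX : ∑ x, noiseOp (1 / 2) a x ^ 2 * noiseOp (1 / 2) b x ^ 2 ≤ c * (A * B) := by
      refine le_of_sq_le_sq ?_ (by positivity)
      refine hcs.trans ?_
      calc _ ≤ (c * A ^ 2) * (c * B ^ 2) :=
            mul_le_mul hA hB (Finset.sum_nonneg fun _ _ => by positivity) (by positivity)
        _ = _ := by ring
    have hAB : 0 ≤ c * (A * B) := by positivity
    have hBB : 0 ≤ c * B ^ 2 := by positivity
    nlinarith

theorem sum_mul_noiseOp (ρ : ℝ) (u v : Cube n → ℝ) :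
    ∑ x, u x * noiseOp ρ v x = ∑ x, noiseOp ρ u x * v x := by
  simp only [noiseOp, smul_eq_mul, Finset.mul_sum, Finset.sum_mul]
  rw [Finset.sum_comm]
  refine Finset.sum_congr rfl fun x _ => Finset.sum_congr rfl fun y _ => ?_
  rw [noiseKernel_comm]
  ring

theorem sum_noiseOp_sq (ρ : ℝ) (g : Cube n → ℝ) :
    ∑ x, noiseOp ρ g x ^ 2 = ∑ x, g x * noiseOp (ρ * ρ) g x := by
  rw [← noiseOp_noiseOp, sum_mul_noiseOp]
  simp only [sq]

theorem sum_noiseOp_half_sq_sq_le (g : Cube n → ℝ) (hg : ∀ x, 0 ≤ g x) :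
    (∑ x, noiseOp (1 / 2) g x ^ 2) ^ 2 ≤
      (2 ^ n : ℝ)⁻¹ * ((∑ x, g x) ^ 2 * ∑ x, g x ^ 2) := by
  set h : Cube n → ℝ := noiseOp (1 / 2) (noiseOp (1 / 2) g) with hh
  set A := ∑ x, noiseOp (1 / 2) g x ^ 2 with hA
  have hA0 : 0 ≤ A := Finset.sum_nonneg fun _ _ => sq_nonneg _
  have hAh : A = ∑ x, g x * h x := by
    rw [hA, sum_noiseOp_sq, hh, noiseOp_noiseOp]
  have h1 : A ^ 2 ≤ (∑ x, g x) * ∑ x, g x * h x ^ 2 := by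
    rw [hAh]
    refine Finset.sum_sq_le_sum_mul_sum_of_sq_le_mul _ (fun x _ => hg x)
      (fun x _ => mul_nonneg (hg x) (sq_nonneg _)) fun x _ => le_of_eq ?_
    ring
  have h2 : (∑ x, g x * h x ^ 2) ^ 2 ≤ (∑ x, g x ^ 2) * ((2 ^ n : ℝ)⁻¹ * A ^ 2) := by
    refine (Finset.sum_mul_sq_le_sq_mul_sq _ _ _).trans ?_
    simp only [← pow_mul]
    exact mul_le_mul_of_nonneg_left (sum_noiseOp_half_pow_four_le _)
      (Finset.sum_nonneg fun _ _ => sq_nonneg _)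
  rcases hA0.eq_or_lt with h0 | h0
  · have : 0 ≤ ∑ x, g x ^ 2 := Finset.sum_nonneg fun _ _ => sq_nonneg _
    rw [← h0, zero_pow two_ne_zero]
    positivity
  · have h3 : A ^ 2 * A ^ 2 ≤
        ((2 ^ n : ℝ)⁻¹ * ((∑ x, g x) ^ 2 * ∑ x, g x ^ 2)) * A ^ 2 := by
      calc A ^ 2 * A ^ 2 = (A ^ 2) ^ 2 := by ring
        _ ≤ ((∑ x, g x) * ∑ x, g x * h x ^ 2) ^ 2 := pow_le_pow_left₀ (sq_nonneg _) h1 2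
        _ = (∑ x, g x) ^ 2 * (∑ x, g x * h x ^ 2) ^ 2 := by ring
        _ ≤ (∑ x, g x) ^ 2 * ((∑ x, g x ^ 2) * ((2 ^ n : ℝ)⁻¹ * A ^ 2)) :=
            mul_le_mul_of_nonneg_left h2 (sq_nonneg _)
        _ = _ := by ring
    exact le_of_mul_le_mul_right h3 (by positivity)

end Hypercontractivity

/-- The noise levels `2 ^ (-2⁻ᵏ)`. -/
def noiseLevel (k : ℕ) : ℝ := Real.exp (-(Real.log 2 / 2 ^ k))

theorem noiseLevel_nonneg (k : ℕ) : 0 ≤ noiseLevel k := (Real.exp_pos _).le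

theorem noiseLevel_le_one (k : ℕ) : noiseLevel k ≤ 1 :=
  Real.exp_le_one_iff.2 (neg_nonpos.2 (div_nonneg (Real.log_nonneg one_le_two) (by positivity)))

theorem noiseLevel_zero : noiseLevel 0 = 1 / 2 := by
  simp [noiseLevel, Real.exp_neg, Real.exp_log]

theorem noiseLevel_succ_mul_self (k : ℕ) :
    noiseLevel (k + 1) * noiseLevel (k + 1) = noiseLevel k := by
  rw [noiseLevel, ← Real.exp_add, noiseLevel]
  congr 1
  field_simp
  ring

theorem one_sub_noiseLevel_le (k : ℕ) : 1 - noiseLevel k ≤ (2 ^ k : ℝ)⁻¹ := by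
  have h1 := Real.add_one_le_exp (-(Real.log 2 / 2 ^ k))
  have h2 : Real.log 2 / 2 ^ k ≤ 1 / 2 ^ k :=
    div_le_div_of_nonneg_right (by linarith [Real.log_two_lt_d9]) (by positivity)
  rw [one_div] at h2
  rw [noiseLevel]
  linarith

section CubeLp

variable {n : ℕ}

theorem cubeLp_two_sq (f : Cube n → E) :
    cubeLp 2 f ^ 2 = (2 ^ n : ℝ)⁻¹ * ∑ x, ‖f x‖ ^ 2 := by
  rw [cubeLp, ← Real.sqrt_eq_rpow]
  simp only [Real.rpow_two]
  exact Real.sq_sqrt (by positivity)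

theorem cubeLp_one (f : Cube n → E) : cubeLp 1 f = (2 ^ n : ℝ)⁻¹ * ∑ x, ‖f x‖ := by
  simp [cubeLp]

theorem cubeLp_nonneg (p : ℝ) (f : Cube n → E) : 0 ≤ cubeLp p f :=
  Real.rpow_nonneg (by positivity) _

theorem cubeLp_one_le_cubeLp_two (f : Cube n → E) : cubeLp 1 f ≤ cubeLp 2 f := by
  refine le_of_sq_le_sq ?_ (cubeLp_nonneg _ _)
  rw [cubeLp_two_sq, cubeLp_one, mul_pow, sq, mul_assoc]
  refine mul_le_mul_of_nonneg_left ?_ (by positivity)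
  rw [inv_mul_le_iff₀ (by positivity)]
  simpa using sq_sum_le_card_mul_sum_sq (s := Finset.univ) (f := fun x : Cube n => ‖f x‖)

theorem eq_zero_of_cubeLp_one_eq_zero {f : Cube n → E} (h : cubeLp 1 f = 0) : f = 0 := by
  rw [cubeLp_one, mul_eq_zero, or_iff_right (by positivity),
    Finset.sum_eq_zero_iff_of_nonneg fun _ _ => norm_nonneg _] at h
  funext x
  simpa using h x (Finset.mem_univ x)

/-- The logarithm of the ratio of the `L_2` and `L_1` norms. -/
def logRatio (f : Cube n → E) : ℝ := Real.log (cubeLp 2 f / cubeLp 1 f)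

theorem one_le_ratio {f : Cube n → E} (h : 0 < cubeLp 1 f) : 1 ≤ cubeLp 2 f / cubeLp 1 f :=
  (one_le_div h).2 (cubeLp_one_le_cubeLp_two f)

theorem logRatio_nonneg (f : Cube n → E) : 0 ≤ logRatio f := by
  rcases (cubeLp_nonneg 1 f).eq_or_lt with h | h
  · simp [logRatio, ← h]
  · exact Real.log_nonneg (one_le_ratio h)

theorem cubeLp_two_noiseOp_sq_le [NormedSpace ℝ E] (f : Cube n → E) (k : ℕ) :
    cubeLp 2 (noiseOp (noiseLevel k) f) ^ 2 ≤
      cubeLp 2 f ^ 2 * Real.exp (-(logRatio f / 2 ^ k)) := by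
  rcases (cubeLp_nonneg 1 f).eq_or_lt with h | h
  · have h0 := eq_zero_of_cubeLp_one_eq_zero h.symm
    have : cubeLp 2 (noiseOp (noiseLevel k) f) ^ 2 = 0 := by
      rw [cubeLp_two_sq, h0]
      simp [noiseOp]
    rw [this]
    positivity
  set g : Cube n → ℝ := fun x => ‖f x‖ with hg
  set c := cubeLp 2 f with hc
  have hc0 : 0 < c := h.trans_le (cubeLp_one_le_cubeLp_two f)
  have hc2 : c ^ 2 = (2 ^ n : ℝ)⁻¹ * ∑ x, g x ^ 2 := cubeLp_two_sq f
  set a : ℕ → ℝ := fun k => (2 ^ n : ℝ)⁻¹ * ∑ x, noiseOp (noiseLevel k) g x ^ 2 with ha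
  have ha0 : ∀ k, 0 ≤ a k := fun k => by positivity
  have hfa : cubeLp 2 (noiseOp (noiseLevel k) f) ^ 2 ≤ a k := by
    rw [cubeLp_two_sq]
    refine mul_le_mul_of_nonneg_left (Finset.sum_le_sum fun x _ => ?_) (by positivity)
    exact pow_le_pow_left₀ (norm_nonneg _)
      (norm_noiseOp_le (noiseLevel_nonneg k) (noiseLevel_le_one k) f x) 2
  refine hfa.trans ?_
  clear hfa
  induction k with
  | zero =>
    have h1 : a 0 ≤ cubeLp 1 f * c := by
      refine le_of_sq_le_sq ?_ (by positivity)
      have := sum_noiseOp_half_sq_sq_le g fun x => norm_nonneg _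
      rw [mul_pow (cubeLp 1 f), hc2, cubeLp_one, ha]
      simp only [noiseLevel_zero]
      calc _ = ((2 ^ n : ℝ)⁻¹) ^ 2 * (∑ x, noiseOp (1 / 2) g x ^ 2) ^ 2 := by ring
        _ ≤ ((2 ^ n : ℝ)⁻¹) ^ 2 * ((2 ^ n : ℝ)⁻¹ * ((∑ x, g x) ^ 2 * ∑ x, g x ^ 2)) :=
            mul_le_mul_of_nonneg_left this (by positivity)
        _ = _ := by ring
    refine h1.trans (le_of_eq ?_)
    rw [logRatio, pow_zero, div_one, Real.exp_neg, Real.exp_log (by positivity)]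
    rw [← hc]
    field_simp
  | succ k ih =>
    refine le_of_sq_le_sq ?_ (by positivity)
    have h1 : a (k + 1) ^ 2 ≤ c ^ 2 * a k := by
      rw [hc2, ha]
      simp only
      rw [sum_noiseOp_sq (noiseLevel (k + 1)), noiseLevel_succ_mul_self, mul_pow]
      calc _ ≤ ((2 ^ n : ℝ)⁻¹) ^ 2 * ((∑ x, g x ^ 2) * ∑ x, noiseOp (noiseLevel k) g x ^ 2) :=
            mul_le_mul_of_nonneg_left (Finset.sum_mul_sq_le_sq_mul_sq _ _ _) (by positivity)
        _ = _ := by ring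
    refine h1.trans ((mul_le_mul_of_nonneg_left ih (by positivity)).trans (le_of_eq ?_))
    rw [mul_pow, ← Real.exp_nat_mul, ← mul_assoc, ← sq]
    congr 2
    push_cast
    field_simp
    ring

end CubeLp

theorem mul_exp_neg_le (z : ℝ) :
    z * Real.exp (-(2 * z)) ≤ Real.exp (-z) - Real.exp (-(2 * z)) := by
  have h1 := mul_le_mul_of_nonneg_right (Real.add_one_le_exp z) (Real.exp_pos (-(2 * z))).le
  rw [← Real.exp_add, show z + -(2 * z) = -z by ring] at h1
  linarith

theorem sum_inv_two_pow_mul_exp_le {l : ℝ} (hl : 0 ≤ l) (m : ℕ) :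
    ∑ k ∈ Finset.range m, (2 ^ k : ℝ)⁻¹ * Real.exp (-(l / 2 ^ k)) ≤ 4 / (1 + l) := by
  have h1 : ∑ k ∈ Finset.range m, (2 ^ k : ℝ)⁻¹ * Real.exp (-(l / 2 ^ k)) ≤ 2 := by
    calc _ ≤ ∑ k ∈ Finset.range m, (1 / 2 : ℝ) ^ k := by
          refine Finset.sum_le_sum fun k _ => ?_
          rw [one_div, inv_pow]
          refine mul_le_of_le_one_right (by positivity) ?_
          exact Real.exp_le_one_iff.2 (neg_nonpos.2 (by positivity))
      _ ≤ 2 := sum_geometric_two_le m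
  have h2 : l * ∑ k ∈ Finset.range m, (2 ^ k : ℝ)⁻¹ * Real.exp (-(l / 2 ^ k)) ≤ 2 := by
    calc _ ≤ ∑ k ∈ Finset.range m,
          2 * (Real.exp (-(l / 2 ^ (k + 1))) - Real.exp (-(l / 2 ^ k))) := by
          rw [Finset.mul_sum]
          refine Finset.sum_le_sum fun k _ => ?_
          have h := mul_exp_neg_le (l / 2 ^ (k + 1))
          have hk : 2 * (l / 2 ^ (k + 1)) = l / 2 ^ k := by
            field_simp
            ring
          rw [hk] at h
          calc _ = 2 * (l / 2 ^ (k + 1) * Real.exp (-(l / 2 ^ k))) := by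
                field_simp
                ring
            _ ≤ _ := by linarith
      _ = 2 * (Real.exp (-(l / 2 ^ m)) - Real.exp (-(l / 2 ^ 0))) := by
          rw [← Finset.mul_sum, Finset.sum_range_sub fun k => Real.exp (-(l / 2 ^ k))]
      _ ≤ 2 := by
          have h3 : Real.exp (-(l / 2 ^ m)) ≤ 1 :=
            Real.exp_le_one_iff.2 (neg_nonpos.2 (by positivity))
          linarith [Real.exp_pos (-(l / 2 ^ 0))]
  rw [le_div_iff₀ (by positivity)]
  linarith

/-- The noise level preceding `noiseLevel k`, starting from `0`. -/
def prevNoiseLevel : ℕ → ℝ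
  | 0 => 0
  | k + 1 => noiseLevel k

theorem exists_noiseLevel_mul_eq_prevNoiseLevel (k : ℕ) :
    ∃ ρ : ℝ, 0 ≤ ρ ∧ ρ ≤ 1 ∧ 1 - ρ ≤ (2 ^ k : ℝ)⁻¹ ∧ ρ * noiseLevel k = prevNoiseLevel k := by
  cases k with
  | zero => exact ⟨0, le_rfl, zero_le_one, by simp, by simp [prevNoiseLevel]⟩
  | succ k =>
    exact ⟨noiseLevel (k + 1), noiseLevel_nonneg _, noiseLevel_le_one _, one_sub_noiseLevel_le _,
      noiseLevel_succ_mul_self k⟩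

theorem norm_add_sum_sq_le (a : E) (m : ℕ) (b : ℕ → E) :
    ‖a + ∑ k ∈ Finset.range (m + 1), b k‖ ^ 2 ≤
      (m + 2) * (‖a‖ ^ 2 + ∑ k ∈ Finset.range (m + 1), ‖b k‖ ^ 2) := by
  have h1 : ‖a + ∑ k ∈ Finset.range (m + 1), b k‖ ≤
      ‖a‖ + ∑ k ∈ Finset.range (m + 1), ‖b k‖ :=
    (norm_add_le _ _).trans (by gcongr; exact norm_sum_le _ _)
  refine (pow_le_pow_left₀ (norm_nonneg _) h1 2).trans ?_
  have h2 := sq_sum_le_card_mul_sum_sq (s := Finset.range (m + 1)) (f := fun k => ‖b k‖)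
  rw [Finset.card_range] at h2
  push_cast at h2
  set S := ∑ k ∈ Finset.range (m + 1), ‖b k‖
  set Q := ∑ k ∈ Finset.range (m + 1), ‖b k‖ ^ 2
  have hm : (0 : ℝ) < m + 1 := by positivity
  have h3 : (m + 1) * (‖a‖ + S) ^ 2 ≤ (m + 1) * ((m + 2) * (‖a‖ ^ 2 + Q)) := by
    nlinarith [sq_nonneg ((m + 1) * ‖a‖ - S)]
  exact le_of_mul_le_mul_left h3 hm

section TypeTwo

variable [NormedSpace ℝ E] {n : ℕ} {T : ℝ}

theorem HasTypeTwo.cubeLp_sub_noiseOp_sq_le (hE : HasTypeTwo E T) {ρ : ℝ}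
    (h0 : 0 ≤ ρ) (h1 : ρ ≤ 1) (f : Cube n → E) :
    cubeLp 2 (fun x => f x - noiseOp ρ f x) ^ 2 ≤
      8 * T ^ 2 * (1 - ρ) * ∑ i, cubeLp 2 (dparC i f) ^ 2 := by
  simp_rw [cubeLp_two_sq, ← Finset.mul_sum]
  rw [mul_left_comm]
  exact mul_le_mul_of_nonneg_left (hE.norm_sub_noiseOp_le h0 h1 f) (by positivity)

theorem HasTypeTwo.cubeLp_noiseOp_sub_noiseOp_sq_le (hE : HasTypeTwo E T) (f : Cube n → E)
    (k : ℕ) :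
    cubeLp 2 (fun x => noiseOp (noiseLevel k) f x - noiseOp (prevNoiseLevel k) f x) ^ 2 ≤
      8 * T ^ 2 * ∑ i, cubeLp 2 (dparC i f) ^ 2 *
        ((2 ^ k : ℝ)⁻¹ * Real.exp (-(logRatio (dparC i f) / 2 ^ k))) := by
  obtain ⟨ρ, h0, h1, hρ, hk⟩ := exists_noiseLevel_mul_eq_prevNoiseLevel k
  rw [← hk, ← noiseOp_noiseOp]
  refine (hE.cubeLp_sub_noiseOp_sq_le h0 h1 _).trans ?_
  rw [mul_assoc]
  refine mul_le_mul_of_nonneg_left ?_ (by positivity)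
  rw [Finset.mul_sum]
  refine Finset.sum_le_sum fun i _ => ?_
  rw [dparC_noiseOp, mul_left_comm]
  exact mul_le_mul hρ (cubeLp_two_noiseOp_sq_le _ k) (sq_nonneg _) (by positivity)

theorem HasTypeTwo.cubeLp_sub_cubeAvg_sq_le (hE : HasTypeTwo E T) (f : Cube n → E) (K : ℕ) :
    cubeLp 2 (fun x => f x - cubeAvg f) ^ 2 ≤
      (K + 2) * (8 * T ^ 2) * ∑ i, cubeLp 2 (dparC i f) ^ 2 * ((2 ^ K : ℝ)⁻¹ +
        ∑ k ∈ Finset.range (K + 1),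
          (2 ^ k : ℝ)⁻¹ * Real.exp (-(logRatio (dparC i f) / 2 ^ k))) := by
  have hx : ∀ x, f x - cubeAvg f = (f x - noiseOp (noiseLevel K) f x) +
      ∑ k ∈ Finset.range (K + 1),
        (noiseOp (noiseLevel k) f x - noiseOp (prevNoiseLevel k) f x) := by
    intro x
    have h : ∑ k ∈ Finset.range (K + 1),
        (noiseOp (noiseLevel k) f x - noiseOp (prevNoiseLevel k) f x) =
        noiseOp (noiseLevel K) f x - noiseOp 0 f x :=
      Finset.sum_range_sub (fun k => noiseOp (prevNoiseLevel k) f x) (K + 1)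
    rw [h, noiseOp_zero]
    abel
  have h1 : cubeLp 2 (fun x => f x - cubeAvg f) ^ 2 ≤ (K + 2) *
      (cubeLp 2 (fun x => f x - noiseOp (noiseLevel K) f x) ^ 2 + ∑ k ∈ Finset.range (K + 1),
        cubeLp 2 (fun x => noiseOp (noiseLevel k) f x - noiseOp (prevNoiseLevel k) f x) ^ 2) := by
    simp_rw [cubeLp_two_sq, ← Finset.mul_sum, ← mul_add]
    rw [mul_left_comm, Finset.sum_comm, ← Finset.sum_add_distrib,
      Finset.mul_sum _ _ ((K : ℝ) + 2)]
    refine mul_le_mul_of_nonneg_left (Finset.sum_le_sum fun x _ => ?_) (by positivity)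
    rw [hx x]
    exact norm_add_sum_sq_le _ _ _
  refine h1.trans ?_
  rw [mul_assoc]
  refine mul_le_mul_of_nonneg_left ?_ (by positivity)
  simp_rw [mul_add, Finset.sum_add_distrib, Finset.mul_sum (Finset.range (K + 1))]
  rw [mul_add, Finset.sum_comm (s := Finset.univ), Finset.mul_sum (Finset.range (K + 1))]
  refine add_le_add ?_ (Finset.sum_le_sum fun k _ => hE.cubeLp_noiseOp_sub_noiseOp_sq_le f k)
  refine (hE.cubeLp_sub_noiseOp_sq_le (noiseLevel_nonneg K) (noiseLevel_le_one K) f).trans ?_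
  rw [← Finset.sum_mul, mul_assoc, mul_comm (∑ i, _)]
  refine mul_le_mul_of_nonneg_left ?_ (by positivity)
  exact mul_le_mul_of_nonneg_right (one_sub_noiseLevel_le K)
    (Finset.sum_nonneg fun _ _ => sq_nonneg _)

end TypeTwo

theorem log_exp_one_add_ge {L : ℝ} (hL : 1 ≤ L) : 5 / 4 ≤ Real.log (Real.exp 1 + L) := by
  have he := Real.exp_pos 1
  have he3 := Real.exp_one_lt_d9
  have h1 : Real.log (Real.exp 1 * (1 + 1 / Real.exp 1)) ≤ Real.log (Real.exp 1 + L) := by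
    refine Real.log_le_log (by positivity) ?_
    rw [mul_add, mul_one_div_cancel he.ne', mul_one]
    linarith
  rw [Real.log_mul he.ne' (by positivity), Real.log_exp] at h1
  have h2 := Real.one_sub_inv_le_log_of_pos (show 0 < 1 + 1 / Real.exp 1 by positivity)
  have h3 : (1 + 1 / Real.exp 1)⁻¹ ≤ 3 / 4 := by
    rw [inv_le_comm₀ (by positivity) (by norm_num)]
    have : (1 : ℝ) / 3 ≤ 1 / Real.exp 1 := one_div_le_one_div_of_le he (by linarith)
    linarith
  linarith

theorem one_fifth_le_log_log {L : ℝ} (hL : 1 ≤ L) :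
    1 / 5 ≤ Real.log (Real.log (Real.exp 1 + L)) := by
  have h1 := log_exp_one_add_ge hL
  have h2 := Real.log_le_log (by norm_num) h1
  have h3 := Real.one_sub_inv_le_log_of_pos (show (0 : ℝ) < 5 / 4 by norm_num)
  norm_num at h3
  linarith

theorem one_add_log_le {L : ℝ} (hL : 1 ≤ L) :
    1 + Real.log L ≤ 2 * Real.exp (Real.log (Real.log (Real.exp 1 + L))) := by
  have h1 := log_exp_one_add_ge hL
  have he := Real.exp_pos 1
  rw [Real.exp_log (by linarith)]
  have h2 : 1 ≤ Real.log (Real.exp 1 + L) := by linarith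
  have h3 : Real.log L ≤ Real.log (Real.exp 1 + L) :=
    Real.log_le_log (by linarith) (by linarith)
  linarith

theorem exists_two_pow_ge {s : ℝ} (hs : 1 / 5 ≤ s) :
    ∃ K : ℕ, 2 * Real.exp s ≤ 2 ^ K ∧ (K : ℝ) + 2 ≤ 22 * s := by
  have hlog := Real.log_two_gt_d9
  have hlog0 : 0 < Real.log 2 := by linarith
  refine ⟨⌈s / Real.log 2⌉₊ + 1, ?_, ?_⟩
  · rw [pow_succ', ← Real.rpow_natCast, Real.rpow_def_of_pos two_pos]
    refine mul_le_mul_of_nonneg_left (Real.exp_le_exp.2 ?_) zero_le_two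
    rw [mul_comm, ← div_le_iff₀ hlog0]
    exact Nat.le_ceil _
  · have h1 := (Nat.ceil_lt_add_one (show 0 ≤ s / Real.log 2 by positivity)).le
    have h2 : s / Real.log 2 ≤ 2 * s := by
      rw [div_le_iff₀ hlog0]
      nlinarith
    push_cast
    linarith

/-- **Vector-valued influence inequality with doubly logarithmic factor** (Theorem 1, eq. (7)).
If `E` is a complex Banach space of Rademacher type 2 with constant `T`, there is
`C = C(T) ∈ (0,∞)` such that, with
`σ(f) = max_i log log (e + ‖∂_i f‖₂/‖∂_i f‖₁)`, every `f : 𝒞_n → E` satisfies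
`‖f - E f‖₂² ≤ C σ(f) ∑_i ‖∂_i f‖₂² / (1 + log(‖∂_i f‖₂/‖∂_i f‖₁))`.
(When `∂_i f ≡ 0`, the corresponding term of `σ(f)` is `log log e = 0` and the `i`-th summand
is `0`, matching the stated conventions.) -/
theorem talagrand_type_two_rademacher_loglog
    (E : Type*) [NormedAddCommGroup E] [NormedSpace ℂ E] [CompleteSpace E]
    (T : ℝ) (hT : 0 < T)
    (htype : ∀ (m : ℕ) (v : Fin m → E),
      (2 ^ m : ℝ)⁻¹ * ∑ ε : Cube m, ‖∑ i, sgn' (ε i) • v i‖ ^ 2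
        ≤ T ^ 2 * ∑ i, ‖v i‖ ^ 2) :
    ∃ C : ℝ, 0 < C ∧ ∀ (n : ℕ) (f : Cube n → E),
      cubeLp 2 (fun x => f x - cubeAvg f) ^ 2
        ≤ C * (⨆ i : Fin n,
              Real.log (Real.log (Real.exp 1 + cubeLp 2 (dparC i f) / cubeLp 1 (dparC i f))))
            * ∑ i : Fin n,
              cubeLp 2 (dparC i f) ^ 2 /
                (1 + Real.log (cubeLp 2 (dparC i f) / cubeLp 1 (dparC i f))) := by
  have hE : HasTypeTwo E T := htype
  refine ⟨880 * T ^ 2, by positivity, fun n f => ?_⟩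
  set σ : Fin n → ℝ := fun i =>
    Real.log (Real.log (Real.exp 1 + cubeLp 2 (dparC i f) / cubeLp 1 (dparC i f))) with hσ
  have hle : ∀ i, σ i ≤ ⨆ j, σ j := fun i => le_ciSup (Set.finite_range σ).bddAbove i
  change _ ≤ 880 * T ^ 2 * (⨆ i, σ i) * ∑ i, cubeLp 2 (dparC i f) ^ 2 / (1 + logRatio (dparC i f))
  by_cases hall : ∀ i, cubeLp 1 (dparC i f) = 0
  · have hzero : ∀ i, cubeLp 2 (dparC i f) ^ 2 = 0 := by
      intro i
      rw [eq_zero_of_cubeLp_one_eq_zero (hall i), cubeLp_two_sq]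
      simp
    have h := hE.cubeLp_sub_cubeAvg_sq_le f 0
    simp only [hzero, zero_mul, zero_div, Finset.sum_const_zero, mul_zero] at h ⊢
    exact h
  · obtain ⟨i₀, hi₀⟩ := not_forall.1 hall
    have hpos : ∀ i, cubeLp 1 (dparC i f) ≠ 0 → 0 < cubeLp 1 (dparC i f) := fun i hi =>
      (cubeLp_nonneg 1 _).lt_of_ne' hi
    have hs : 1 / 5 ≤ ⨆ i, σ i :=
      (one_fifth_le_log_log (one_le_ratio (hpos i₀ hi₀))).trans (hle i₀)
    obtain ⟨K, hK1, hK2⟩ := exists_two_pow_ge hs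
    have hlog : ∀ i, 1 + logRatio (dparC i f) ≤ 2 ^ K := by
      intro i
      refine le_trans ?_ hK1
      by_cases hi : cubeLp 1 (dparC i f) = 0
      · have := Real.add_one_le_exp (⨆ j, σ j)
        simp only [logRatio, hi, div_zero, Real.log_zero]
        linarith
      · refine (one_add_log_le (one_le_ratio (hpos i hi))).trans ?_
        exact mul_le_mul_of_nonneg_left (Real.exp_le_exp.2 (hle i)) zero_le_two
    refine (hE.cubeLp_sub_cubeAvg_sq_le f K).trans ?_
    have hsum : ∑ i, cubeLp 2 (dparC i f) ^ 2 * ((2 ^ K : ℝ)⁻¹ +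
        ∑ k ∈ Finset.range (K + 1),
          (2 ^ k : ℝ)⁻¹ * Real.exp (-(logRatio (dparC i f) / 2 ^ k))) ≤
        5 * ∑ i, cubeLp 2 (dparC i f) ^ 2 / (1 + logRatio (dparC i f)) := by
      rw [Finset.mul_sum]
      refine Finset.sum_le_sum fun i _ => ?_
      have hl := logRatio_nonneg (dparC i f)
      have h1 : (2 ^ K : ℝ)⁻¹ ≤ (1 + logRatio (dparC i f))⁻¹ :=
        inv_anti₀ (by positivity) (hlog i)
      have h2 := sum_inv_two_pow_mul_exp_le hl (K + 1)
      rw [div_eq_mul_inv, mul_left_comm]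
      rw [div_eq_mul_inv] at h2
      exact mul_le_mul_of_nonneg_left (by linarith) (sq_nonneg _)
    have hS : 0 ≤ ∑ i, cubeLp 2 (dparC i f) ^ 2 / (1 + logRatio (dparC i f)) :=
      Finset.sum_nonneg fun i _ =>
        div_nonneg (sq_nonneg _) (by linarith [logRatio_nonneg (dparC i f)])
    clear hle hlog hpos hi₀ hall hs
    clear_value σ
    generalize ∑ i, cubeLp 2 (dparC i f) ^ 2 / (1 + logRatio (dparC i f)) = S at hS hsum ⊢
    generalize (⨆ i, σ i) = s at hK1 hK2 ⊢
    refine (mul_le_mul_of_nonneg_left hsum (by positivity)).trans ?_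
    have hTS : 0 ≤ 40 * T ^ 2 * S := by positivity
    have h := mul_le_mul_of_nonneg_right hK2 hTS
    linear_combination h

end
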